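/- The efficient influence function has mean zero: Σ_d p(d) · ψ̃(d) = 0, where ψ̃(g, x, z, t, t', y, y') = [𝟙{x = c, t = a} / p(X = c, T = a)] · ( Y(y) − Σ_{y₀} Y(y₀) · p_O(y₀ | z, t) ) + [𝟙{x = c} / p(X = c)] · ( Σ_{y₀} Y(y₀) · p_O(y₀ | z, a) − Ψ(p) ) and Ψ(p) = Σ_z p(z | X = c) · Σ_{y'} Y(y') · p(y' | z, T' = a). -/

import Mathlib

/-- Tuple of values `(g, x, z, t, t', y, y')` for the causal model of Figure 1. -/
structure Tup (𝒢 𝒳 𝒵 𝒯 𝒴 : Type*) where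
  g : 𝒢
  x : 𝒳
  z : 𝒵
  t : 𝒯
  t' : 𝒯
  y : 𝒴
  y' : 𝒴

instance {𝒢 𝒳 𝒵 𝒯 𝒴 : Type*} [Fintype 𝒢] [Fintype 𝒳] [Fintype 𝒵] [Fintype 𝒯] [Fintype 𝒴] :
    Fintype (Tup 𝒢 𝒳 𝒵 𝒯 𝒴) :=
  Fintype.ofEquiv (𝒢 × 𝒳 × 𝒵 × 𝒯 × 𝒯 × 𝒴 × 𝒴)
    { toFun := fun p => ⟨p.1, p.2.1, p.2.2.1, p.2.2.2.1, p.2.2.2.2.1, p.2.2.2.2.2.1, p.2.2.2.2.2.2⟩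
      invFun := fun d => (d.g, d.x, d.z, d.t, d.t', d.y, d.y')
      left_inv := fun _ => rfl
      right_inv := fun _ => rfl }

/-- Probability of an event under a pmf `p` on a finite type. -/
noncomputable def Pr {D : Type*} [Fintype D] (p : D → ℝ) (E : Set D) : ℝ :=
  ∑ d, E.indicator p d

/-- Conditional probability `p(A | B)`, defined as a ratio of marginal sums of `p`. -/
noncomputable def condPr {D : Type*} [Fintype D] (p : D → ℝ) (A B : Set D) : ℝ :=
  Pr p (A ∩ B) / Pr p B

/-- The joint pmf factorizing along the Bayesian network of Figure 1. -/
noncomputable def joint {𝒢 𝒳 𝒵 𝒯 𝒴 : Type*} (pG : 𝒢 → ℝ) (pX : 𝒳 → ℝ)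
    (pT pT' : 𝒯 → 𝒳 → ℝ) (pZ : 𝒵 → 𝒢 → 𝒳 → ℝ) (pO : 𝒴 → 𝒵 → 𝒯 → ℝ)
    (d : Tup 𝒢 𝒳 𝒵 𝒯 𝒴) : ℝ :=
  pG d.g * pX d.x * pT d.t d.x * pT' d.t' d.x * pZ d.z d.g d.x * pO d.y d.z d.t * pO d.y' d.z d.t'

/-- The causal parameter `Ψ(q) = Σ_z q(z | X = c) · Σ_{y'} Y(y') · q(y' | z, T' = a)`. -/
noncomputable def Psi {𝒢 𝒳 𝒵 𝒯 𝒴 : Type*} [Fintype 𝒢] [Fintype 𝒳] [Fintype 𝒵] [Fintype 𝒯]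
    [Fintype 𝒴] (Yv : 𝒴 → ℝ) (c : 𝒳) (a : 𝒯) (q : Tup 𝒢 𝒳 𝒵 𝒯 𝒴 → ℝ) : ℝ :=
  ∑ z, condPr q {d | d.z = z} {d | d.x = c}
    * ∑ y0, Yv y0 * condPr q {d | d.y' = y0} {d | d.z = z ∧ d.t' = a}

/-- The efficient influence function
`ψ̃(g, x, z, t, t', y, y') = 𝟙{x = c, t = a} / p(X = c, T = a) · (Y(y) - Σ_{y₀} Y(y₀) p_O(y₀ | z, t))
  + 𝟙{x = c} / p(X = c) · (Σ_{y₀} Y(y₀) p_O(y₀ | z, a) - Ψ(p))`. -/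
noncomputable def eif {𝒢 𝒳 𝒵 𝒯 𝒴 : Type*} [Fintype 𝒢] [Fintype 𝒳] [Fintype 𝒵] [Fintype 𝒯]
    [Fintype 𝒴] [DecidableEq 𝒳] [DecidableEq 𝒯] (pO : 𝒴 → 𝒵 → 𝒯 → ℝ) (Yv : 𝒴 → ℝ)
    (c : 𝒳) (a : 𝒯) (p : Tup 𝒢 𝒳 𝒵 𝒯 𝒴 → ℝ) (d : Tup 𝒢 𝒳 𝒵 𝒯 𝒴) : ℝ :=
  (if d.x = c ∧ d.t = a then 1 else 0) / Pr p {d | d.x = c ∧ d.t = a}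
      * (Yv d.y - ∑ y0, Yv y0 * pO y0 d.z d.t)
    + (if d.x = c then 1 else 0) / Pr p {d | d.x = c}
      * ((∑ y0, Yv y0 * pO y0 d.z a) - Psi Yv c a p)

theorem sumTup {𝒢 𝒳 𝒵 𝒯 𝒴 : Type*} [Fintype 𝒢] [Fintype 𝒳] [Fintype 𝒵] [Fintype 𝒯] [Fintype 𝒴]
    (f : Tup 𝒢 𝒳 𝒵 𝒯 𝒴 → ℝ) :
    ∑ d, f d = ∑ g, ∑ x, ∑ z, ∑ t, ∑ t', ∑ y, ∑ y', f ⟨g, x, z, t, t', y, y'⟩ := by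
  have h := Fintype.sum_bijective
    (fun p : 𝒢 × 𝒳 × 𝒵 × 𝒯 × 𝒯 × 𝒴 × 𝒴 => (⟨p.1, p.2.1, p.2.2.1, p.2.2.2.1, p.2.2.2.2.1,
      p.2.2.2.2.2.1, p.2.2.2.2.2.2⟩ : Tup 𝒢 𝒳 𝒵 𝒯 𝒴))
    (Function.bijective_iff_has_inverse.2
      ⟨fun d => (d.g, d.x, d.z, d.t, d.t', d.y, d.y'), fun _ => rfl, fun _ => rfl⟩)
    _ f (fun _ => rfl)
  rw [← h]
  simp only [Fintype.sum_prod_type]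

theorem sum_y' {𝒢 𝒳 𝒵 𝒯 𝒴 : Type*} [Fintype 𝒢] [Fintype 𝒳] [Fintype 𝒵] [Fintype 𝒯] [Fintype 𝒴]
    (pG : 𝒢 → ℝ) (pX : 𝒳 → ℝ) (pT pT' : 𝒯 → 𝒳 → ℝ)
    (pZ : 𝒵 → 𝒢 → 𝒳 → ℝ) (pO : 𝒴 → 𝒵 → 𝒯 → ℝ) (hpO1 : ∀ z t, ∑ y, pO y z t = 1)
    (k : 𝒵 → 𝒯 → ℝ) (u : 𝒴 → ℝ) :
    ∑ d, joint pG pX pT pT' pZ pO d * (k d.z d.t' * u d.y')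
      = ∑ d, joint pG pX pT pT' pZ pO d * (k d.z d.t' * ∑ y0, pO y0 d.z d.t' * u y0) := by
  rw [sumTup, sumTup]
  refine Finset.sum_congr rfl fun g _ => Finset.sum_congr rfl fun x _ =>
    Finset.sum_congr rfl fun z _ => Finset.sum_congr rfl fun t _ =>
    Finset.sum_congr rfl fun t' _ => Finset.sum_congr rfl fun y _ => ?_
  simp only [joint]
  rw [← Finset.sum_mul, ← Finset.mul_sum, hpO1, mul_one, ← mul_assoc, Finset.mul_sum]
  exact Finset.sum_congr rfl fun y' _ => by ring

theorem sum_y {𝒢 𝒳 𝒵 𝒯 𝒴 : Type*} [Fintype 𝒢] [Fintype 𝒳] [Fintype 𝒵] [Fintype 𝒯] [Fintype 𝒴]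
    (pG : 𝒢 → ℝ) (pX : 𝒳 → ℝ) (pT pT' : 𝒯 → 𝒳 → ℝ)
    (pZ : 𝒵 → 𝒢 → 𝒳 → ℝ) (pO : 𝒴 → 𝒵 → 𝒯 → ℝ) (hpO1 : ∀ z t, ∑ y, pO y z t = 1)
    (k : 𝒳 → 𝒯 → ℝ) (Yv : 𝒴 → ℝ) :
    ∑ d, joint pG pX pT pT' pZ pO d * (k d.x d.t * (Yv d.y - ∑ y0, Yv y0 * pO y0 d.z d.t)) = 0 := by
  rw [sumTup]
  refine Finset.sum_eq_zero fun g _ => Finset.sum_eq_zero fun x _ =>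
    Finset.sum_eq_zero fun z _ => Finset.sum_eq_zero fun t _ =>
    Finset.sum_eq_zero fun t' _ => ?_
  simp only [joint]
  simp_rw [← Finset.sum_mul, ← Finset.mul_sum, hpO1]
  set m := ∑ y0, Yv y0 * pO y0 z t with hm
  have h : ∑ y, pO y z t * (Yv y - m) = 0 := by
    simp_rw [mul_sub]
    rw [Finset.sum_sub_distrib, ← Finset.sum_mul, hpO1, one_mul, hm, sub_eq_zero]
    exact Finset.sum_congr rfl fun y _ => mul_comm _ _
  rw [← mul_zero (pG g * pX x * pT t x * pT' t' x * pZ z g x * k x t), ← h, Finset.mul_sum]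
  exact Finset.sum_congr rfl fun y _ => by ring

theorem Pr_pos_of {D : Type*} [Fintype D] (p : D → ℝ) (hpos : ∀ d, 0 < p d) (E : Set D)
    (d : D) (hd : d ∈ E) : 0 < Pr p E := by
  unfold Pr
  refine Finset.sum_pos' (fun i _ => Set.indicator_nonneg (fun j _ => (hpos j).le) i)
    ⟨d, Finset.mem_univ _, ?_⟩
  rw [Set.indicator_of_mem hd]
  exact hpos d

/-- The efficient influence function has mean zero: `Σ_d p(d) ψ̃(d) = 0`. -/
theorem efficient_influence_function_mean_zero
    {𝒢 𝒳 𝒵 𝒯 𝒴 : Type*} [Fintype 𝒢] [Fintype 𝒳] [Fintype 𝒵] [Fintype 𝒯] [Fintype 𝒴]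
    [Nonempty 𝒢] [Nonempty 𝒳] [Nonempty 𝒵] [Nonempty 𝒯] [Nonempty 𝒴]
    (pG : 𝒢 → ℝ) (pX : 𝒳 → ℝ) (pT pT' : 𝒯 → 𝒳 → ℝ)
    (pZ : 𝒵 → 𝒢 → 𝒳 → ℝ) (pO : 𝒴 → 𝒵 → 𝒯 → ℝ)
    (p : Tup 𝒢 𝒳 𝒵 𝒯 𝒴 → ℝ)
    (hp : ∀ d, p d = joint pG pX pT pT' pZ pO d)
    (hpG0 : ∀ g, 0 ≤ pG g) (hpG1 : ∑ g, pG g = 1)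
    (hpX0 : ∀ x, 0 ≤ pX x) (hpX1 : ∑ x, pX x = 1)
    (hpT0 : ∀ t x, 0 ≤ pT t x) (hpT1 : ∀ x, ∑ t, pT t x = 1)
    (hpT'0 : ∀ t x, 0 ≤ pT' t x) (hpT'1 : ∀ x, ∑ t, pT' t x = 1)
    (hpZ0 : ∀ z g x, 0 ≤ pZ z g x) (hpZ1 : ∀ g x, ∑ z, pZ z g x = 1)
    (hpO0 : ∀ y z t, 0 ≤ pO y z t) (hpO1 : ∀ z t, ∑ y, pO y z t = 1)
    (hpos : ∀ d, 0 < p d)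
    [DecidableEq 𝒳] [DecidableEq 𝒯]
    (Yv : 𝒴 → ℝ) (a : 𝒯) (c : 𝒳) :
    ∑ d, p d * eif pO Yv c a p d = 0 := by
  classical
  obtain rfl : p = joint pG pX pT pT' pZ pO := funext hp
  set p := joint pG pX pT pT' pZ pO with hpdef
  obtain ⟨g₀⟩ := ‹Nonempty 𝒢›
  obtain ⟨z₀⟩ := ‹Nonempty 𝒵›
  obtain ⟨y₀⟩ := ‹Nonempty 𝒴›
  have hc : 0 < Pr p {d | d.x = c} := Pr_pos_of p hpos _ ⟨g₀, c, z₀, a, a, y₀, y₀⟩ rfl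
  have hcond : ∀ z y0, condPr p {d | d.y' = y0} {d | d.z = z ∧ d.t' = a} = pO y0 z a := by
    intro z y0
    have hB : 0 < Pr p {d | d.z = z ∧ d.t' = a} :=
      Pr_pos_of p hpos _ ⟨g₀, c, z, a, a, y₀, y₀⟩ ⟨rfl, rfl⟩
    rw [condPr, div_eq_iff hB.ne']
    have h := sum_y' pG pX pT pT' pZ pO hpO1 (fun z1 t1 => if z1 = z ∧ t1 = a then 1 else 0)
      (fun y => if y = y0 then 1 else 0)
    rw [← hpdef] at h
    unfold Pr
    rw [Finset.mul_sum]
    convert h using 1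
    · refine Finset.sum_congr rfl fun d _ => ?_
      by_cases h1 : d.z = z ∧ d.t' = a <;> by_cases h2 : d.y' = y0 <;>
        simp [Set.indicator, h1, h2]
    · refine Finset.sum_congr rfl fun d _ => ?_
      by_cases h1 : d.z = z ∧ d.t' = a
      · simp [Set.indicator, h1, mul_comm]
      · simp [Set.indicator, h1]
  have h1 := sum_y pG pX pT pT' pZ pO hpO1
    (fun x t => (if x = c ∧ t = a then 1 else 0) / Pr p {d | d.x = c ∧ d.t = a}) Yv
  rw [← hpdef] at h1
  have hPsi : Psi Yv c a p * Pr p {d | d.x = c}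
      = ∑ d, p d * ((if d.x = c then 1 else 0) * ∑ y0, Yv y0 * pO y0 d.z a) := by
    unfold Psi
    simp_rw [hcond]
    rw [Finset.sum_mul]
    have : ∀ z, condPr p {d | d.z = z} {d | d.x = c} * (∑ y0, Yv y0 * pO y0 z a)
        * Pr p {d | d.x = c}
        = ∑ d, if z = d.z then p d * ((if d.x = c then 1 else 0) * ∑ y0, Yv y0 * pO y0 d.z a)
          else 0 := by
      intro z
      rw [condPr, div_mul_eq_mul_div, div_mul_cancel₀ _ hc.ne', Pr, Finset.sum_mul]
      refine Finset.sum_congr rfl fun d _ => ?_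
      by_cases e : z = d.z
      · subst e
        by_cases e2 : d.x = c <;> simp [Set.indicator, e2]
      · have e' : ¬ d.z = z := fun q => e q.symm
        simp [Set.indicator, e, e']
    rw [Finset.sum_congr rfl fun z _ => this z, Finset.sum_comm]
    simp
  have hPr : Pr p {d | d.x = c} = ∑ d, p d * (if d.x = c then 1 else 0) := by
    unfold Pr
    refine Finset.sum_congr rfl fun d _ => ?_
    simp [Set.indicator]
  unfold eif
  simp_rw [mul_add]
  rw [Finset.sum_add_distrib, h1, zero_add]
  have h2 : ∑ d, p d * ((if d.x = c then 1 else 0) / Pr p {d | d.x = c}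
      * ((∑ y0, Yv y0 * pO y0 d.z a) - Psi Yv c a p))
      = ((∑ d, p d * ((if d.x = c then 1 else 0) * ∑ y0, Yv y0 * pO y0 d.z a))
        - Psi Yv c a p * ∑ d, p d * (if d.x = c then 1 else 0)) / Pr p {d | d.x = c} := by
    rw [Finset.mul_sum, ← Finset.sum_sub_distrib, Finset.sum_div]
    exact Finset.sum_congr rfl fun d _ => by ring
  rw [h2, ← hPsi, ← hPr, sub_self, zero_div]
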